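/- Let x ∈ J be of rank k, let c be the unique idempotent of rank k with c·x = x, and let ω ∈ Ω have Peirce decomposition ω = ω₁ + ω_{1/2} + ω₀ relative to c. Then, as t → 0⁺, det(x + tω) = t^{r−k} det_c(x) det_{e−c}(ω₀) + O(t^{r−k+1}). -/

import Mathlib

open scoped BigOperators Classical

/-- Bare data of a (real) Jordan algebra: a bilinear product and a unit element. -/
structure JordanData (J : Type) [AddCommGroup J] [Module ℝ J] where
  mul : J →ₗ[ℝ] J →ₗ[ℝ] J
  e : J

namespace JordanData

variable {J : Type} [AddCommGroup J] [Module ℝ J] (A : JordanData J)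

/-- `c` is an idempotent. -/
def IsIdem (c : J) : Prop := A.mul c c = c

/-- `c` is a primitive idempotent: a nonzero idempotent which dominates only `0` and itself. -/
def IsPrimitive (c : J) : Prop :=
  A.IsIdem c ∧ c ≠ 0 ∧ ∀ d : J, A.IsIdem d → A.mul c d = d → d = 0 ∨ d = c

/-- A Jordan frame: a complete system of pairwise orthogonal primitive idempotents. -/
def IsFrame {m : ℕ} (c : Fin m → J) : Prop :=
  (∀ j, A.IsPrimitive (c j)) ∧ (∀ i j, i ≠ j → A.mul (c i) (c j) = 0) ∧ ∑ j, c j = A.e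

end JordanData

/-- A simple Euclidean Jordan algebra of rank `rank`, together with its trace `tr`
and determinant `jdet` (characterized by their values on spectral decompositions). -/
structure EJA (J : Type) [NormedAddCommGroup J] [NormedSpace ℝ J] [FiniteDimensional ℝ J]
    extends JordanData J where
  comm : ∀ x y : J, mul x y = mul y x
  unit_mul : ∀ x : J, mul e x = x
  jordan : ∀ x y : J, mul (mul x x) (mul x y) = mul x (mul (mul x x) y)
  tr : J →ₗ[ℝ] ℝ
  tr_posdef : ∀ x : J, x ≠ 0 → 0 < tr (mul x x)
  simple : ∀ I : Submodule ℝ J, (∀ x ∈ I, ∀ y : J, mul y x ∈ I) → I = ⊥ ∨ I = ⊤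
  rank : ℕ
  spectral : ∀ x : J, ∃ (c : Fin rank → J) (lam : Fin rank → ℝ),
    toJordanData.IsFrame c ∧ x = ∑ j, lam j • c j
  tr_prim : ∀ c : J, toJordanData.IsPrimitive c → tr c = 1
  jdet : J → ℝ
  jdet_frame : ∀ (c : Fin rank → J) (lam : Fin rank → ℝ),
    toJordanData.IsFrame c → jdet (∑ j, lam j • c j) = ∏ j, lam j

namespace EJA

variable {J : Type} [NormedAddCommGroup J] [NormedSpace ℝ J] [FiniteDimensional ℝ J]

def IsIdem (A : EJA J) (c : J) : Prop := A.toJordanData.IsIdem c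

def IsPrimitive (A : EJA J) (c : J) : Prop := A.toJordanData.IsPrimitive c

def IsFrame (A : EJA J) {m : ℕ} (c : Fin m → J) : Prop := A.toJordanData.IsFrame c

/-- `x` has rank `k`: in a spectral decomposition of `x`, exactly `k` eigenvalues are nonzero. -/
def HasRank (A : EJA J) (x : J) (k : ℕ) : Prop :=
  ∃ (c : Fin A.rank → J) (lam : Fin A.rank → ℝ), A.IsFrame c ∧
    x = ∑ j, lam j • c j ∧ (Finset.univ.filter fun j => lam j ≠ 0).card = k

/-- The symmetric cone `Ω`: the interior of the set of squares. -/
def cone (A : EJA J) : Set J := interior {x : J | ∃ y : J, x = A.mul y y}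

/-- The Peirce space `J(c,t)`, i.e. the `t`-eigenspace of the multiplication operator `L(c)`. -/
def peirce (A : EJA J) (c : J) (t : ℝ) : Submodule ℝ J :=
  LinearMap.ker (A.mul c - t • (LinearMap.id : J →ₗ[ℝ] J))

/-- The symmetric cone of the Jordan subalgebra `J(c,t)` (`t = 1` or `t = 0`):
the relative interior, within `J(c,t)`, of the set of squares of elements of `J(c,t)`. -/
def subCone (A : EJA J) (c : J) (t : ℝ) : Set J :=
  {x : J | x ∈ A.peirce c t ∧ ∃ U : Set J, IsOpen U ∧ x ∈ U ∧
    ∀ y ∈ U, y ∈ A.peirce c t → ∃ w ∈ A.peirce c t, y = A.mul w w}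

/-- Powers in the Jordan algebra, with `x ^ 0 = e`. -/
def pow (A : EJA J) (x : J) : ℕ → J
  | 0 => A.e
  | n + 1 => A.mul x (A.pow x n)

/-- `y` is the Jordan inverse of `x`: `y` lies in the subalgebra `ℝ[x]` and `x·y = e`. -/
def IsInverse (A : EJA J) (x y : J) : Prop :=
  y ∈ Submodule.span ℝ (Set.range (A.pow x)) ∧ A.mul x y = A.e

/-- The set of invertible linear maps preserving the symmetric cone. -/
def conePreserving (A : EJA J) : Set (J →L[ℝ] J)ˣ :=
  {g | (g : J →L[ℝ] J) '' A.cone = A.cone}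

theorem one_mem_conePreserving (A : EJA J) : 1 ∈ A.conePreserving := by
  show (↑(1 : (J →L[ℝ] J)ˣ) : J →L[ℝ] J) '' A.cone = A.cone
  simp

/-- The group `L`: the identity component of the group of linear transformations of `J`
preserving the symmetric cone `Ω`. -/
def Lgroup (A : EJA J) : Set (J →L[ℝ] J)ˣ :=
  {g | ∃ h : g ∈ A.conePreserving,
    (⟨g, h⟩ : A.conePreserving) ∈ connectedComponent ⟨1, A.one_mem_conePreserving⟩}

end EJA

open Asymptotics

namespace EJA

variable {J : Type} [NormedAddCommGroup J] [NormedSpace ℝ J] [FiniteDimensional ℝ J]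

theorem mem_peirce' (A : EJA J) (c z : J) (t : ℝ) : z ∈ A.peirce c t ↔ A.mul c z = t • z := by
  simp [peirce, LinearMap.mem_ker, sub_eq_zero]

/-- The fully linearized Jordan identity. -/
theorem jordan_lin (A : EJA J) (a b c y : J) :
    A.mul (A.mul a b) (A.mul c y) + A.mul (A.mul b c) (A.mul a y) + A.mul (A.mul c a) (A.mul b y)
    = A.mul c (A.mul (A.mul a b) y) + A.mul a (A.mul (A.mul b c) y)
      + A.mul b (A.mul (A.mul c a) y) := by
  have h1 := A.jordan (a + b + c) y
  have h2 := A.jordan (a + b) y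
  have h3 := A.jordan (b + c) y
  have h4 := A.jordan (a + c) y
  have h5 := A.jordan a y
  have h6 := A.jordan b y
  have h7 := A.jordan c y
  simp only [map_add, LinearMap.add_apply, A.comm b a, A.comm c a, A.comm c b] at h1 h2 h3 h4 ⊢
  linear_combination (norm := module) (1/2 : ℝ) • (h1 - h2 - h3 - h4 + h5 + h6 + h7)

theorem idem_lin (A : EJA J) {c : J} (hc : A.mul c c = c) (z y : J) :
    A.mul c (A.mul z y) + (2:ℝ) • A.mul (A.mul c z) (A.mul c y)
    = A.mul z (A.mul c y) + (2:ℝ) • A.mul c (A.mul (A.mul c z) y) := by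
  have h := A.jordan_lin c c z y
  rw [hc, A.comm z c] at h
  linear_combination (norm := module) h

theorem idem_cubic (A : EJA J) {c : J} (hc : A.mul c c = c) (z : J) :
    (2:ℝ) • A.mul c (A.mul c (A.mul c z)) = (3:ℝ) • A.mul c (A.mul c z) - A.mul c z := by
  have h := A.idem_lin hc z c
  rw [hc, A.comm z c, A.comm (A.mul c z) c] at h
  linear_combination (norm := module) -h

theorem comm0 (A : EJA J) {c z : J} (hc : A.mul c c = c) (hz : A.mul c z = 0) (y : J) :
    A.mul c (A.mul z y) = A.mul z (A.mul c y) := by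
  have h := A.idem_lin hc z y
  simpa [hz] using h

theorem comm1 (A : EJA J) {c z : J} (hc : A.mul c c = c) (hz : A.mul c z = z) (y : J) :
    A.mul c (A.mul z y) = A.mul z (A.mul c y) := by
  have h := A.idem_lin hc z y
  rw [hz] at h
  linear_combination (norm := module) -h

theorem commE (A : EJA J) {c z : J} (hc : A.mul c c = c)
    (hz : A.mul c (A.mul c z) = A.mul c z) (y : J) :
    A.mul c (A.mul z y) = A.mul z (A.mul c y) := by
  have h1 := A.comm1 hc hz y
  have h0 := A.comm0 (z := z - A.mul c z) hc (by simp [hz]) y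
  simp only [map_sub, LinearMap.sub_apply] at h0
  linear_combination (norm := module) h1 + h0

theorem mul10 (A : EJA J) {c z w : J} (hc : A.mul c c = c) (hz : A.mul c z = z)
    (hw : A.mul c w = 0) : A.mul z w = 0 := by
  have h1 := A.comm1 hc hz w
  have h0 := A.comm0 hc hw z
  rw [hw, map_zero] at h1
  rw [hz, A.comm w z, h1] at h0
  exact h0.symm

theorem mulHH (A : EJA J) {c z w : J} (hc : A.mul c c = c) (hz : A.mul c z = (1/2:ℝ) • z)
    (hw : A.mul c w = (1/2:ℝ) • w) :
    A.mul c (A.mul c (A.mul z w)) = A.mul c (A.mul z w) := by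
  have h := A.jordan_lin c z w c
  have hz' := A.comm z c
  have hw' := A.comm w c
  rw [hc, hz', hw', hz, hw] at h
  simp only [map_smul, LinearMap.smul_apply, hz', hw', hz, hw] at h
  rw [A.comm w z, A.comm (A.mul z w) c] at h
  linear_combination (norm := module) -h

/-- half component -/
def hp (A : EJA J) (c : J) (w : J) : J := (4:ℝ) • (A.mul c w - A.mul c (A.mul c w))

theorem hp_half (A : EJA J) {c : J} (hc : A.mul c c = c) (w : J) :
    A.mul c (A.hp c w) = (1/2:ℝ) • A.hp c w := by
  have h := A.idem_cubic hc w
  simp only [hp, map_smul, map_sub]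
  linear_combination (norm := module) (-2:ℝ) • h

theorem ev_part (A : EJA J) {c : J} (hc : A.mul c c = c) (w : J) :
    A.mul c (A.mul c (w - A.hp c w)) = A.mul c (w - A.hp c w) := by
  have h := A.hp_half hc w
  simp only [map_sub, map_smul, h]
  unfold hp
  module

/-- the Peirce reflection -/
def refl (A : EJA J) (c : J) (w : J) : J := w - (2:ℝ) • A.hp c w

theorem refl_of_ev (A : EJA J) {c w : J} (hw : A.mul c (A.mul c w) = A.mul c w) :
    A.refl c w = w := by
  simp [refl, hp, hw]

theorem refl_of_half (A : EJA J) {c w : J} (hw : A.mul c w = (1/2:ℝ) • w) :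
    A.refl c w = -w := by
  simp only [refl, hp, hw, map_smul]
  module

theorem refl_add (A : EJA J) (c v w : J) : A.refl c (v + w) = A.refl c v + A.refl c w := by
  simp only [refl, hp, map_add]
  module

theorem refl_smul (A : EJA J) (c : J) (s : ℝ) (w : J) : A.refl c (s • w) = s • A.refl c w := by
  simp only [refl, hp, map_smul]
  module

theorem refl_decomp (A : EJA J) {c : J} (hc : A.mul c c = c) (w : J) :
    ∃ u v, w = u + v ∧ A.mul c (A.mul c u) = A.mul c u ∧ A.mul c v = (1/2:ℝ) • v :=
  ⟨w - A.hp c w, A.hp c w, by simp, A.ev_part hc w, A.hp_half hc w⟩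

theorem refl_refl (A : EJA J) {c : J} (hc : A.mul c c = c) (w : J) :
    A.refl c (A.refl c w) = w := by
  obtain ⟨u, v, rfl, hu, hv⟩ := A.refl_decomp hc w
  rw [refl_add, A.refl_of_ev hu, A.refl_of_half hv, refl_add, A.refl_of_ev hu]
  have : -v = (-1:ℝ) • v := by simp
  rw [this, refl_smul, A.refl_of_half hv]
  simp

theorem refl_mul (A : EJA J) {c : J} (hc : A.mul c c = c) (w w' : J) :
    A.refl c (A.mul w w') = A.mul (A.refl c w) (A.refl c w') := by
  obtain ⟨u, v, rfl, hu, hv⟩ := A.refl_decomp hc w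
  obtain ⟨u', v', rfl, hu', hv'⟩ := A.refl_decomp hc w'
  simp only [map_add, LinearMap.add_apply, refl_add, A.refl_of_ev hu, A.refl_of_half hv,
    A.refl_of_ev hu', A.refl_of_half hv', map_neg, LinearMap.neg_apply]
  have e1 : A.refl c (A.mul u u') = A.mul u u' := by
    apply A.refl_of_ev
    rw [A.commE hc hu, A.commE hc hu, hu']
  have e2 : A.refl c (A.mul v v') = A.mul v v' := A.refl_of_ev (A.mulHH hc hv hv')
  have e3 : A.refl c (A.mul u v') = -A.mul u v' := by
    apply A.refl_of_half
    rw [A.commE hc hu, hv', map_smul]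
  have e4 : A.refl c (A.mul v u') = -A.mul v u' := by
    apply A.refl_of_half
    rw [A.comm v u', A.commE hc hu', hv, map_smul]
  rw [e1, e2, e3, e4]
  abel

theorem refl_zero (A : EJA J) (c : J) : A.refl c 0 = 0 := by simp [refl, hp]

theorem refl_prim (A : EJA J) {c d : J} (hc : A.mul c c = c) (hd : A.IsPrimitive d) :
    A.IsPrimitive (A.refl c d) := by
  obtain ⟨h1, h2, h3⟩ := hd
  refine ⟨?_, ?_, ?_⟩
  · show A.mul _ _ = _
    rw [← A.refl_mul hc]
    exact congrArg _ h1
  · intro h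
    apply h2
    rw [← A.refl_refl hc d, h, refl_zero]
  · intro f hf hdf
    have hf' : A.mul (A.refl c f) (A.refl c f) = A.refl c f := by
      rw [← A.refl_mul hc]
      exact congrArg _ hf
    have := h3 (A.refl c f) hf' (by
      have := congrArg (A.refl c) hdf
      rwa [A.refl_mul hc, A.refl_refl hc] at this)
    rcases this with h | h
    · left
      rw [← A.refl_refl hc f, h, refl_zero]
    · right
      rw [← A.refl_refl hc f, h]

theorem refl_sum (A : EJA J) (c : J) {ι : Type} (s : Finset ι) (f : ι → J) :
    A.refl c (∑ i ∈ s, f i) = ∑ i ∈ s, A.refl c (f i) := by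
  classical
  induction s using Finset.induction_on with
  | empty => simp [refl_zero]
  | insert a s ha ih => rw [Finset.sum_insert ha, Finset.sum_insert ha, refl_add, ih]

theorem tr_refl (A : EJA J) {c : J} (hc : A.mul c c = c) (w : J) :
    A.tr (A.refl c w) = A.tr w := by
  obtain ⟨f, lam, hf, rfl⟩ := A.spectral w
  rw [refl_sum, map_sum, map_sum]
  refine Finset.sum_congr rfl fun j _ => ?_
  rw [refl_smul, map_smul, map_smul, A.tr_prim _ (hf.1 j), A.tr_prim _ (A.refl_prim hc (hf.1 j))]

theorem tr_half (A : EJA J) {c w : J} (hc : A.mul c c = c) (hw : A.mul c w = (1/2:ℝ) • w) :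
    A.tr w = 0 := by
  have := A.tr_refl hc w
  rw [A.refl_of_half hw, map_neg] at this
  linarith

theorem tr_cc (A : EJA J) {c : J} (hc : A.mul c c = c) (w : J) :
    A.tr (A.mul c (A.mul c w)) = A.tr (A.mul c w) := by
  have := A.tr_half hc (A.hp_half hc w)
  simp only [hp, map_smul, map_sub, smul_eq_mul] at this
  linarith

theorem tr_cd (A : EJA J) {c d : J} (hc : A.mul c c = c) (hcd : A.mul c d = 0) (w : J) :
    A.tr (A.mul c (A.mul d w)) = 0 := by
  obtain ⟨u, v, rfl, hu, hv⟩ := A.refl_decomp hc w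
  have hcomm := A.comm0 hc hcd
  have h1 : A.mul d (A.mul c u) = 0 := by
    rw [A.comm]
    exact A.mul10 hc hu hcd
  rw [hcomm, map_add, map_add, h1, zero_add, hv, map_smul, map_smul]
  rw [A.tr_half (c := c) hc, smul_zero]
  rw [hcomm, hv, map_smul]

theorem tr_sq (A : EJA J) (a w : J) :
    A.tr (A.mul a (A.mul a w)) = A.tr (A.mul (A.mul a a) w) := by
  obtain ⟨f, lam, hf, rfl⟩ := A.spectral a
  obtain ⟨h1, h2, h3⟩ := hf
  simp only [map_sum, map_smul, LinearMap.sum_apply, LinearMap.smul_apply, smul_eq_mul]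
  refine Finset.sum_congr rfl fun i _ => ?_
  rw [Finset.mul_sum, Finset.mul_sum]
  refine Finset.sum_congr rfl fun j _ => ?_
  congr 2
  by_cases hij : i = j
  · subst hij
    rw [A.tr_cc (h1 i).1, show A.mul (f i) (f i) = f i from (h1 i).1]
  · have e1 : A.mul (f i) (f j) = 0 := h2 i j hij
    have e2 : A.mul (f j) (f i) = 0 := h2 j i (Ne.symm hij)
    first
    | simp [e1, A.tr_cd (h1 i).1 e1]
    | simp [e2, A.tr_cd (h1 j).1 e2]

/-- Associativity of the trace form. -/
theorem tr_assoc (A : EJA J) (a b w : J) :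
    A.tr (A.mul a (A.mul b w)) = A.tr (A.mul (A.mul a b) w) := by
  have key : ∀ a b w : J, A.tr (A.mul a (A.mul b w)) + A.tr (A.mul b (A.mul a w))
      = 2 * A.tr (A.mul w (A.mul a b)) := by
    intro a b w
    have h1 := A.tr_sq (a + b) w
    have h2 := A.tr_sq a w
    have h3 := A.tr_sq b w
    simp only [map_add, LinearMap.add_apply, A.comm b a] at h1
    rw [A.comm w]
    linarith
  have k1 := key a b w
  have k2 := key a w b
  rw [A.comm w b] at k2
  rw [A.comm (A.mul a b) w]
  linarith

end EJA

namespace EJA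

variable {J : Type} [NormedAddCommGroup J] [NormedSpace ℝ J] [FiniteDimensional ℝ J]

theorem pow_frame (A : EJA J) {m : ℕ} {f : Fin m → J} (hf : A.IsFrame f) (lam : Fin m → ℝ)
    (n : ℕ) : A.pow (∑ j, lam j • f j) n = ∑ j, lam j ^ n • f j := by
  obtain ⟨h1, h2, h3⟩ := hf
  induction n with
  | zero => simpa [pow] using h3.symm
  | succ n ih =>
    rw [pow, ih]
    simp only [map_sum, map_smul, LinearMap.sum_apply, LinearMap.smul_apply]
    refine Finset.sum_congr rfl fun i _ => ?_
    rw [Finset.sum_eq_single i]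
    · rw [show A.mul (f i) (f i) = f i from (h1 i).1, smul_smul, pow_succ]
    · intro j _ hj
      have e2 : A.mul (f j) (f i) = 0 := h2 j i hj
      simp [e2]
    · simp

theorem frame_mul (A : EJA J) {ι : Type} [Fintype ι] {f : ι → J}
    (h1 : ∀ j, A.IsPrimitive (f j)) (h2 : ∀ i j, i ≠ j → A.mul (f i) (f j) = 0)
    (lam mu : ι → ℝ) : A.mul (∑ j, lam j • f j) (∑ j, mu j • f j) = ∑ j, (lam j * mu j) • f j := by
  simp only [map_sum, map_smul, LinearMap.sum_apply, LinearMap.smul_apply]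
  refine Finset.sum_congr rfl fun i _ => ?_
  rw [Finset.sum_eq_single i]
  · rw [show A.mul (f i) (f i) = f i from (h1 i).1, smul_smul]
    first | rfl | rw [mul_comm]
  · intro j _ hj
    have e2 : A.mul (f j) (f i) = 0 := h2 j i hj
    simp [e2]
  · simp

theorem pow_add' (A : EJA J) (y : J) (m n : ℕ) :
    A.mul (A.pow y m) (A.pow y n) = A.pow y (m + n) := by
  obtain ⟨f, lam, hf, rfl⟩ := A.spectral y
  rw [A.pow_frame hf, A.pow_frame hf, A.pow_frame hf, A.frame_mul hf.1 hf.2.1]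
  simp [pow_add]

theorem tr_e (A : EJA J) : A.tr A.e = A.rank := by
  obtain ⟨f, lam, hf, -⟩ := A.spectral 0
  rw [← hf.2.2, map_sum, Finset.sum_congr rfl fun j _ => A.tr_prim _ (hf.1 j)]
  simp

theorem frame_coeff (A : EJA J) {ι : Type} [Fintype ι] {f : ι → J}
    (h1 : ∀ j, A.IsPrimitive (f j)) (h2 : ∀ i j, i ≠ j → A.mul (f i) (f j) = 0)
    (lam : ι → ℝ) (i : ι) : A.mul (f i) (∑ j, lam j • f j) = lam i • f i := by
  simp only [map_sum, map_smul]
  rw [Finset.sum_eq_single i]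
  · rw [show A.mul (f i) (f i) = f i from (h1 i).1]
  · intro j _ hj
    rw [h2 i j (Ne.symm hj), smul_zero]
  · simp

theorem idem_coeff (A : EJA J) {ι : Type} [Fintype ι] {f : ι → J}
    (h1 : ∀ j, A.IsPrimitive (f j)) (h2 : ∀ i j, i ≠ j → A.mul (f i) (f j) = 0)
    (lam : ι → ℝ) (hid : A.IsIdem (∑ j, lam j • f j)) (i : ι) : lam i = 0 ∨ lam i = 1 := by
  have hid' : A.mul (∑ j, lam j • f j) (∑ j, lam j • f j) = (∑ j, lam j • f j) := hid
  rw [A.frame_mul h1 h2] at hid'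
  have h := congrArg (A.mul (f i)) hid'
  rw [A.frame_coeff h1 h2 (fun j => lam j * lam j), A.frame_coeff h1 h2] at h
  have h' := smul_left_injective ℝ (h1 i).2.1 h
  have : lam i * (lam i - 1) = 0 := by
    have : lam i * lam i = lam i := h'
    linarith
  rcases mul_eq_zero.1 this with h | h
  · exact Or.inl h
  · exact Or.inr (by linarith)

theorem tr_of_rank (A : EJA J) {c : J} {k : ℕ} (hc : A.IsIdem c) (hck : A.HasRank c k) :
    A.tr c = k ∧ k ≤ A.rank := by
  obtain ⟨f, lam, hf, rfl, hk⟩ := hck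
  constructor
  · rw [map_sum, ← hk, Finset.card_filter, Nat.cast_sum]
    refine Finset.sum_congr rfl fun j _ => ?_
    rw [map_smul, A.tr_prim _ (hf.1 j)]
    rcases A.idem_coeff hf.1 hf.2.1 lam hc j with h | h <;> simp [h]
  · rw [← hk]
    simpa using Finset.card_filter_le (Finset.univ : Finset (Fin A.rank)) (fun j => lam j ≠ 0)

theorem sum_nz {ι : Type} [Fintype ι] (lam : ι → ℝ) (G : ι → J) (h : ∀ j, lam j = 0 → G j = 0) :
    ∑ j : {j // lam j ≠ 0}, G j = ∑ j, G j := by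
  rw [← Finset.sum_subtype (Finset.univ.filter fun j => lam j ≠ 0) (by simp) G]
  refine Finset.sum_filter_of_ne fun j _ hj => ?_
  exact fun h' => hj (h j h')

/-- Spectral decomposition inside the Peirce-one algebra of an idempotent `p`. -/
theorem spectral_sub (A : EJA J) {p z : J} (hp : A.IsIdem p) (hz : A.mul p z = z) :
    ∃ (ι : Type) (_ : Fintype ι) (d : ι → J) (lam : ι → ℝ), (∀ j, A.IsPrimitive (d j)) ∧
      (∀ i j, i ≠ j → A.mul (d i) (d j) = 0) ∧ ∑ j, d j = p ∧ z = ∑ j, lam j • d j := by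
  have hp' : A.mul p p = p := hp
  obtain ⟨f, lam, hf, hzf⟩ := A.spectral z
  obtain ⟨h1, h2, h3⟩ := hf
  have hpol : ∀ q : Polynomial ℝ, A.mul p (∑ j, (lam j * q.eval (lam j)) • f j)
      = ∑ j, (lam j * q.eval (lam j)) • f j := by
    intro q
    induction q using Polynomial.induction_on' with
    | add q q' hq hq' =>
      simp only [Polynomial.eval_add, mul_add, add_smul, Finset.sum_add_distrib, map_add, hq, hq']
    | monomial n a =>
      have hn : ∀ n, A.mul p (∑ j, (lam j ^ (n + 1)) • f j) = ∑ j, (lam j ^ (n + 1)) • f j := by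
        intro n
        induction n with
        | zero => simpa [← hzf] using hz
        | succ n ih =>
          have e : ∑ j, (lam j ^ (n + 1 + 1)) • f j = A.mul z (∑ j, (lam j ^ (n + 1)) • f j) := by
            rw [hzf, A.frame_mul h1 h2]
            refine Finset.sum_congr rfl fun j _ => ?_
            rw [pow_succ']
          rw [e, A.comm1 hp' hz, ih]
      have e : ∑ j, (lam j * (Polynomial.monomial n a).eval (lam j)) • f j
          = a • ∑ j, (lam j ^ (n + 1)) • f j := by
        rw [Finset.smul_sum]
        refine Finset.sum_congr rfl fun j _ => ?_
        rw [smul_smul, Polynomial.eval_monomial]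
        congr 1
        ring
      rw [e, map_smul, hn]
  set q : Polynomial ℝ := Lagrange.interpolate (Finset.univ.image lam) id (fun x => x⁻¹) with hq
  have hqe : ∀ j, q.eval (lam j) = (lam j)⁻¹ := fun j =>
    Lagrange.eval_interpolate_at_node (v := id) (fun x => x⁻¹) (Set.injOn_id _)
      (Finset.mem_image_of_mem lam (Finset.mem_univ j))
  have hpc := hpol q
  set nu : Fin A.rank → ℝ := fun j => lam j * q.eval (lam j) with hnu
  have hnu0 : ∀ j, lam j = 0 → nu j = 0 := fun j h => by simp [hnu, h]
  have hnu1 : ∀ j, lam j ≠ 0 → nu j = 1 := fun j h => by simp [hnu, hqe, h]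
  set c' : J := ∑ j, nu j • f j with hc'
  have hcc : A.mul c' c' = c' := by
    rw [hc', A.frame_mul h1 h2]
    refine Finset.sum_congr rfl fun j _ => ?_
    by_cases h : lam j = 0
    · simp [hnu0 j h]
    · simp [hnu1 j h]
  have hpid : A.mul (p - c') (p - c') = p - c' := by
    simp only [map_sub, LinearMap.sub_apply, hp', hpc, A.comm c' p, hcc]
    abel
  have hcp : A.mul c' (p - c') = 0 := by
    rw [map_sub, A.comm c' p, hpc, hcc, sub_self]
  obtain ⟨g, mu, hg, hgm⟩ := A.spectral (p - c')
  obtain ⟨g1, g2, g3⟩ := hg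
  have hmu : ∀ j, mu j = 0 ∨ mu j = 1 := A.idem_coeff g1 g2 mu (by rw [← hgm]; exact hpid)
  have hfc : ∀ j, lam j ≠ 0 → A.mul c' (f j) = f j := by
    intro j hj
    rw [A.comm, hc', A.frame_coeff h1 h2, hnu1 j hj, one_smul]
  have hgc : ∀ j, mu j ≠ 0 → A.mul (p - c') (g j) = g j := by
    intro j hj
    rw [A.comm, hgm, A.frame_coeff g1 g2, (hmu j).resolve_left hj, one_smul]
  have hfp : ∀ j, lam j ≠ 0 → A.mul (p - c') (f j) = 0 := by
    intro j hj
    rw [A.comm]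
    exact A.mul10 hcc (hfc j hj) hcp
  have hgf : ∀ i j, mu i ≠ 0 → lam j ≠ 0 → A.mul (g i) (f j) = 0 := fun i j hi hj =>
    A.mul10 hpid (hgc i hi) (hfp j hj)
  refine ⟨{j // lam j ≠ 0} ⊕ {j // mu j ≠ 0}, inferInstance,
    Sum.elim (fun j => f j) (fun j => g j), Sum.elim (fun j => lam j) (fun _ => 0), ?_, ?_, ?_, ?_⟩
  · rintro (j | j)
    · exact h1 j
    · exact g1 j
  · rintro (i | i) (j | j) hij
    · exact h2 i j (fun h => hij (by rw [Subtype.ext h]))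
    · show A.mul (f i) (g j) = 0
      rw [A.comm]
      exact hgf j i j.2 i.2
    · exact hgf i j i.2 j.2
    · exact g2 i j (fun h => hij (by rw [Subtype.ext h]))
  · rw [Fintype.sum_sum_type]
    simp only [Sum.elim_inl, Sum.elim_inr]
    have e1 : ∑ j : {j // lam j ≠ 0}, f j = c' := by
      rw [hc', ← sum_nz lam (fun j => nu j • f j) (fun j h => by simp [hnu0 j h])]
      exact Finset.sum_congr rfl fun j _ => by rw [hnu1 j j.2, one_smul]
    have e2 : ∑ j : {j // mu j ≠ 0}, g j = p - c' := by
      rw [hgm, ← sum_nz mu (fun j => mu j • g j) (fun j h => by simp [h])]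
      exact Finset.sum_congr rfl fun j _ => by rw [(hmu j).resolve_left j.2, one_smul]
    rw [e1, e2]
    abel
  · rw [Fintype.sum_sum_type]
    simp only [Sum.elim_inl, Sum.elim_inr, zero_smul, Finset.sum_const_zero, add_zero]
    rw [hzf]
    exact (sum_nz lam (fun j => lam j • f j) (fun j h => by simp [h])).symm

theorem jdet_fintype (A : EJA J) {ι : Type} [Fintype ι] (d : ι → J) (lam : ι → ℝ)
    (h1 : ∀ j, A.IsPrimitive (d j)) (h2 : ∀ i j, i ≠ j → A.mul (d i) (d j) = 0)
    (h3 : ∑ j, d j = A.e) : A.jdet (∑ j, lam j • d j) = ∏ j, lam j := by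
  have hcard : Fintype.card ι = A.rank := by
    have h := A.tr_e
    rw [← h3, map_sum, Finset.sum_congr rfl fun j _ => A.tr_prim _ (h1 j)] at h
    simpa using h
  let φ : Fin A.rank ≃ ι := (Fintype.equivFinOfCardEq hcard).symm
  rw [← φ.sum_comp, ← φ.prod_comp]
  refine A.jdet_frame (fun j => d (φ j)) (fun j => lam (φ j)) ⟨fun j => h1 _, fun i j hij =>
    h2 _ _ (fun h => hij (φ.injective h)), ?_⟩
  rw [φ.sum_comp]
  exact h3

theorem jdet_prod (A : EJA J) {c x ω0 : J} (hc : A.IsIdem c) (hcx : A.mul c x = x)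
    (h0 : A.mul c ω0 = 0) (detc det0 : J → ℝ)
    (hdetc : ∀ (m : ℕ) (d : Fin m → J) (lam : Fin m → ℝ),
      (∀ j, A.IsPrimitive (d j)) → (∀ i j, i ≠ j → A.mul (d i) (d j) = 0) →
      (∑ j, d j = c) → detc (∑ j, lam j • d j) = ∏ j, lam j)
    (hdet0 : ∀ (m : ℕ) (d : Fin m → J) (lam : Fin m → ℝ),
      (∀ j, A.IsPrimitive (d j)) → (∀ i j, i ≠ j → A.mul (d i) (d j) = 0) →
      (∑ j, d j = A.e - c) → det0 (∑ j, lam j • d j) = ∏ j, lam j) :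
    A.jdet (x + ω0) = detc x * det0 ω0 := by
  have hc' : A.mul c c = c := hc
  have hec : A.IsIdem (A.e - c) := by
    show A.mul _ _ = _
    simp only [map_sub, LinearMap.sub_apply, A.unit_mul, A.comm c A.e, hc']
    abel
  obtain ⟨ι, _, d, lam, d1, d2, d3, d4⟩ := A.spectral_sub hc hcx
  obtain ⟨κ, _, g, mu, g1, g2, g3, g4⟩ := A.spectral_sub (z := ω0) hec
    (by rw [map_sub, LinearMap.sub_apply, A.unit_mul, h0, sub_zero])
  have hd : ∀ i, A.mul c (d i) = d i := by
    intro i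
    have := A.frame_coeff d1 d2 (fun _ => 1) i
    simp only [one_smul] at this
    rwa [d3, A.comm] at this
  have hg : ∀ i, A.mul c (g i) = 0 := by
    intro i
    have := A.frame_coeff g1 g2 (fun _ => 1) i
    simp only [one_smul] at this
    rw [g3, A.comm, map_sub, LinearMap.sub_apply, A.unit_mul] at this
    simpa using this
  have E1 : detc x = ∏ j, lam j := by
    let φ := (Fintype.equivFin ι).symm
    rw [d4, ← φ.sum_comp, ← φ.prod_comp]
    refine hdetc _ (fun j => d (φ j)) (fun j => lam (φ j)) (fun j => d1 _) (fun i j hij =>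
      d2 _ _ (fun h => hij (φ.injective h))) ?_
    rw [φ.sum_comp]
    exact d3
  have E2 : det0 ω0 = ∏ j, mu j := by
    let φ := (Fintype.equivFin κ).symm
    rw [g4, ← φ.sum_comp, ← φ.prod_comp]
    refine hdet0 _ (fun j => g (φ j)) (fun j => mu (φ j)) (fun j => g1 _) (fun i j hij =>
      g2 _ _ (fun h => hij (φ.injective h))) ?_
    rw [φ.sum_comp]
    exact g3
  have := A.jdet_fintype (Sum.elim d g) (Sum.elim lam mu) (by
      rintro (j | j)
      · exact d1 j
      · exact g1 j) (by
      rintro (i | i) (j | j) hij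
      · exact d2 i j (fun h => hij (by rw [h]))
      · exact A.mul10 hc' (hd i) (hg j)
      · show A.mul (g i) (d j) = 0
        rw [A.comm]
        exact A.mul10 hc' (hd j) (hg i)
      · exact g2 i j (fun h => hij (by rw [h]))) (by
      rw [Fintype.sum_sum_type]
      simp [d3, g3])
  rw [Fintype.sum_sum_type, Fintype.prod_sum_type] at this
  simp only [Sum.elim_inl, Sum.elim_inr] at this
  rw [← d4, ← g4] at this
  rw [this, E1, E2]

end EJA

theorem newton_exists (r : ℕ) (n : ℕ) : ∃ P : MvPolynomial ℕ ℝ, ∀ lam : Fin r → ℝ,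
    MvPolynomial.eval (fun n => ∑ j, lam j ^ n) P
      = MvPolynomial.eval lam (MvPolynomial.esymm (Fin r) ℝ n) := by
  induction n using Nat.strong_induction_on with
  | _ n ih =>
    rcases Nat.eq_zero_or_pos n with rfl | hn
    · exact ⟨1, fun lam => by simp⟩
    · choose! P hP using ih
      refine ⟨MvPolynomial.C ((n:ℝ)⁻¹) * ((-1) ^ (n + 1) *
        ∑ a ∈ Finset.HasAntidiagonal.antidiagonal n with a.1 < n, (-1) ^ a.1 * P a.1 * MvPolynomial.X a.2),
        fun lam => ?_⟩
      have h := congrArg (MvPolynomial.eval lam) (MvPolynomial.mul_esymm_eq_sum (Fin r) ℝ n)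
      have hn' : (n:ℝ) ≠ 0 := by positivity
      simp only [map_mul, map_sum, map_pow, map_neg, map_one, map_natCast,
        MvPolynomial.eval_C, MvPolynomial.eval_X, MvPolynomial.psum] at h ⊢
      rw [inv_mul_eq_iff_eq_mul₀ hn', h]
      congr 1
      refine Finset.sum_congr rfl fun a ha => ?_
      rw [hP a.1 (Finset.mem_filter.1 ha).2]

theorem newton_prod (r : ℕ) : ∃ P : MvPolynomial ℕ ℝ, ∀ lam : Fin r → ℝ,
    MvPolynomial.eval (fun n => ∑ j, lam j ^ n) P = ∏ j, lam j := by
  obtain ⟨P, hP⟩ := newton_exists r r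
  refine ⟨P, fun lam => ?_⟩
  rw [hP, MvPolynomial.esymm]
  have : Finset.powersetCard r (Finset.univ : Finset (Fin r)) = {Finset.univ} := by
    have h := Finset.powersetCard_self (Finset.univ : Finset (Fin r))
    rwa [Finset.card_fin] at h
  simp [this]

theorem eval_deriv_congr (P : MvPolynomial ℕ ℝ) (f g : ℕ → ℝ → ℝ) (v : ℕ → ℝ) (s : ℝ)
    (hfg : ∀ n, f n s = g n s) (hf : ∀ n, HasDerivAt (f n) (v n) s)
    (hg : ∀ n, HasDerivAt (g n) (v n) s) :
    MvPolynomial.eval (fun n => f n s) P = MvPolynomial.eval (fun n => g n s) P ∧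
    ∃ d, HasDerivAt (fun u => MvPolynomial.eval (fun n => f n u) P) d s ∧
      HasDerivAt (fun u => MvPolynomial.eval (fun n => g n u) P) d s := by
  induction P using MvPolynomial.induction_on with
  | C a => exact ⟨by simp, 0, by simpa using hasDerivAt_const s a, by
      simpa using hasDerivAt_const s a⟩
  | add p q hp hq =>
    obtain ⟨e1, d1, a1, b1⟩ := hp
    obtain ⟨e2, d2, a2, b2⟩ := hq
    refine ⟨by simp [e1, e2], d1 + d2, ?_, ?_⟩
    · simpa using a1.fun_add a2
    · simpa using b1.fun_add b2
  | mul_X p n hp =>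
    obtain ⟨e1, d1, a1, b1⟩ := hp
    refine ⟨by simp [hfg],
      d1 * f n s + MvPolynomial.eval (fun n => f n s) p * v n, ?_, ?_⟩
    · simpa using a1.fun_mul (hf n)
    · rw [e1, hfg]
      simpa using b1.fun_mul (hg n)

theorem eval_polynomial (P : MvPolynomial ℕ ℝ) (f : ℕ → ℝ → ℝ)
    (hf : ∀ n, ∃ q : Polynomial ℝ, ∀ t, f n t = q.eval t) :
    ∃ q : Polynomial ℝ, ∀ t, MvPolynomial.eval (fun n => f n t) P = q.eval t := by
  induction P using MvPolynomial.induction_on with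
  | C a => exact ⟨Polynomial.C a, fun t => by simp⟩
  | add p q hp hq =>
    obtain ⟨p', hp⟩ := hp
    obtain ⟨q', hq⟩ := hq
    exact ⟨p' + q', fun t => by simp [hp, hq]⟩
  | mul_X p n hp =>
    obtain ⟨p', hp⟩ := hp
    obtain ⟨q', hq⟩ := hf n
    exact ⟨p' * q', fun t => by simp [hp, hq]⟩

namespace EJA

variable {J : Type} [NormedAddCommGroup J] [NormedSpace ℝ J] [FiniteDimensional ℝ J]

/-- polynomial curves -/
def PC (γ : ℝ → J) : Prop :=
  γ ∈ Submodule.span ℝ (Set.range fun nv : ℕ × J => fun t : ℝ => t ^ nv.1 • nv.2)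

theorem PC.mono (n : ℕ) (v : J) : PC (fun t : ℝ => t ^ n • v) :=
  Submodule.subset_span ⟨(n, v), rfl⟩

theorem PC.add {γ δ : ℝ → J} (h : PC γ) (h' : PC δ) : PC (fun t => γ t + δ t) :=
  Submodule.add_mem _ h h'

theorem PC.mul (A : EJA J) {γ δ : ℝ → J} (h : PC γ) (h' : PC δ) :
    PC (fun t => A.mul (γ t) (δ t)) := by
  unfold PC at h
  induction h using Submodule.span_induction with
  | mem γ hγ =>
    obtain ⟨⟨n, v⟩, rfl⟩ := hγ
    unfold PC at h'
    induction h' using Submodule.span_induction with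
    | mem δ hδ =>
      obtain ⟨⟨m, w⟩, rfl⟩ := hδ
      have := PC.mono (n + m) (A.mul v w)
      convert this using 2 with t
      simp [smul_smul, pow_add, mul_comm]
    | zero =>
      simp only [Pi.zero_apply, map_zero]
      exact Submodule.zero_mem _
    | add δ δ' _ _ h1 h2 =>
      simp only [Pi.add_apply, map_add]
      exact PC.add h1 h2
    | smul a δ _ h1 =>
      have := Submodule.smul_mem _ a h1
      simp only [Pi.smul_apply, (A.mul _).map_smul a]
      exact this
  | zero =>
    simp only [Pi.zero_apply, map_zero, LinearMap.zero_apply]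
    exact Submodule.zero_mem _
  | add δ δ' _ _ h1 h2 =>
    simp only [Pi.add_apply, map_add, LinearMap.add_apply]
    exact PC.add h1 h2
  | smul a δ _ h1 =>
    simp only [Pi.smul_apply, map_smul, LinearMap.smul_apply]
    exact Submodule.smul_mem _ a h1

theorem PC.pow (A : EJA J) {γ : ℝ → J} (h : PC γ) (n : ℕ) : PC (fun t => A.pow (γ t) n) := by
  induction n with
  | zero => simpa [EJA.pow] using PC.mono 0 A.e
  | succ n ih => exact PC.mul A h ih

theorem PC.lin {γ : ℝ → J} (h : PC γ) (l : J →ₗ[ℝ] ℝ) :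
    ∃ q : Polynomial ℝ, ∀ t, l (γ t) = q.eval t := by
  unfold PC at h
  induction h using Submodule.span_induction with
  | mem γ hγ =>
    obtain ⟨⟨n, v⟩, rfl⟩ := hγ
    exact ⟨Polynomial.C (l v) * Polynomial.X ^ n, fun t => by
      rw [map_smul, smul_eq_mul, Polynomial.eval_mul, Polynomial.eval_C, Polynomial.eval_pow,
        Polynomial.eval_X, mul_comm]⟩
  | zero => exact ⟨0, fun t => by simp⟩
  | add δ δ' _ _ h1 h2 =>
    obtain ⟨p, hp⟩ := h1
    obtain ⟨q, hq⟩ := h2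
    exact ⟨p + q, fun t => by simp [hp, hq]⟩
  | smul a δ _ h1 =>
    obtain ⟨p, hp⟩ := h1
    exact ⟨Polynomial.C a * p, fun t => by simp [hp]⟩

theorem jdet_newton (A : EJA J) {P : MvPolynomial ℕ ℝ} (hP : ∀ lam : Fin A.rank → ℝ,
    MvPolynomial.eval (fun n => ∑ j, lam j ^ n) P = ∏ j, lam j) (y : J) :
    A.jdet y = MvPolynomial.eval (fun n => A.tr (A.pow y n)) P := by
  obtain ⟨f, lam, hf, rfl⟩ := A.spectral y
  rw [A.jdet_frame f lam hf, ← hP]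
  congr 2 with n
  rw [A.pow_frame hf, map_sum]
  refine Finset.sum_congr rfl fun j _ => ?_
  rw [map_smul, A.tr_prim _ (hf.1 j)]
  simp

theorem PC.jdet (A : EJA J) {γ : ℝ → J} (h : PC γ) :
    ∃ q : Polynomial ℝ, ∀ t, A.jdet (γ t) = q.eval t := by
  obtain ⟨P, hP⟩ := newton_prod A.rank
  obtain ⟨q, hq⟩ := eval_polynomial P (fun n t => A.tr (A.pow (γ t) n))
    (fun n => PC.lin (PC.pow A h n) A.tr)
  exact ⟨q, fun t => by rw [A.jdet_newton hP, hq]⟩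

theorem hasDerivAt_mul (A : EJA J) {γ δ : ℝ → J} {γ' δ' : J} {s : ℝ} (h : HasDerivAt γ γ' s)
    (h' : HasDerivAt δ δ' s) :
    HasDerivAt (fun t => A.mul (γ t) (δ t)) (A.mul γ' (δ s) + A.mul (γ s) δ') s := by
  let L : J →L[ℝ] (J →L[ℝ] J) := LinearMap.toContinuousLinearMap
    ((LinearMap.toContinuousLinearMap : (J →ₗ[ℝ] J) ≃ₗ[ℝ] (J →L[ℝ] J)).toLinearMap ∘ₗ A.mul)
  have h1 := (L.hasFDerivAt.comp_hasDerivAt s h).clm_apply h'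
  exact h1

theorem hasDerivAt_pow (A : EJA J) {γ : ℝ → J} {γ' : J} {s : ℝ} (h : HasDerivAt γ γ' s) (p : J)
    (hp : s • γ' = (2:ℝ) • A.mul p (γ s)) (n : ℕ) :
    ∃ D, HasDerivAt (fun t => A.pow (γ t) n) D s ∧
      ∀ m, s * A.tr (A.mul (A.pow (γ s) m) D) = n * (2 * A.tr (A.mul p (A.pow (γ s) (m + n)))) := by
  induction n with
  | zero => exact ⟨0, by simpa [EJA.pow] using hasDerivAt_const s A.e, fun m => by simp⟩
  | succ n ih =>
    obtain ⟨D, hD, hm⟩ := ih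
    refine ⟨_, A.hasDerivAt_mul h hD, fun m => ?_⟩
    have e1 : A.mul (A.pow (γ s) m) (γ s) = A.pow (γ s) (m + 1) := by
      rw [A.comm]
      rfl
    have e2 := hm (m + 1)
    rw [← e1, ← A.tr_assoc] at e2
    have e3 : s * A.tr (A.mul (A.pow (γ s) m) (A.mul γ' (A.pow (γ s) n)))
        = 2 * A.tr (A.mul p (A.pow (γ s) (m + (n + 1)))) := by
      rw [A.comm γ', A.tr_assoc, A.pow_add', ← smul_eq_mul, ← map_smul, ← map_smul, hp,
        map_smul, map_smul, smul_eq_mul, A.comm p, A.tr_assoc, A.comm (A.pow (γ s) (m + n)) (γ s),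
        A.comm p, ← add_assoc]
      rfl
    rw [map_add, map_add, mul_add, e3, e2, show m + 1 + n = m + (n + 1) by ring]
    push_cast
    ring

theorem jdet_deriv (A : EJA J) {γ : ℝ → J} {γ' : J} {s : ℝ} (hs : s ≠ 0)
    (h : HasDerivAt γ γ' s) (p : J) (hp : s • γ' = (2:ℝ) • A.mul p (γ s)) :
    HasDerivAt (fun t => A.jdet (γ t)) (2 * A.tr p / s * A.jdet (γ s)) s := by
  obtain ⟨P, hP⟩ := newton_prod A.rank
  obtain ⟨f, lam, hf, hy⟩ := A.spectral (γ s)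
  choose D hD hm using A.hasDerivAt_pow h p hp
  set a : Fin A.rank → ℝ := fun j => 2 * A.tr (A.mul p (f j)) / s with ha
  have hsum : ∑ j, a j = 2 * A.tr p / s := by
    rw [ha, ← Finset.sum_div, ← Finset.mul_sum, ← map_sum, ← map_sum, hf.2.2, A.comm, A.unit_mul]
  have hlin : ∀ j, HasDerivAt (fun u => lam j * (1 + a j * (u - s))) (lam j * a j) s := by
    intro j
    have := ((((hasDerivAt_id s).sub_const s).const_mul (a j)).const_add 1).const_mul (lam j)
    simpa using this
  have hval : ∀ n, A.tr (A.pow (γ s) n) = ∑ j, lam j ^ n := by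
    intro n
    rw [hy, A.pow_frame hf, map_sum]
    refine Finset.sum_congr rfl fun j _ => ?_
    rw [map_smul, A.tr_prim _ (hf.1 j)]
    simp
  have key := eval_deriv_congr P (fun n u => A.tr (A.pow (γ u) n))
    (fun n u => ∑ j, (lam j * (1 + a j * (u - s))) ^ n) (fun n => A.tr (D n)) s
    (fun n => by simp [hval])
    (fun n => by
      have := (LinearMap.toContinuousLinearMap A.tr).hasFDerivAt.comp_hasDerivAt s (hD n)
      exact this)
    (fun n => by
      have h1 : HasDerivAt (fun u => ∑ j, (lam j * (1 + a j * (u - s))) ^ n)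
        (∑ j, (n : ℝ) * (lam j * (1 + a j * (s - s))) ^ (n - 1) * (lam j * a j)) s :=
        HasDerivAt.fun_sum fun j _ => (hlin j).fun_pow n
      convert h1 using 1
      have h2 := hm n 0
      rw [show A.pow (γ s) 0 = A.e from rfl, A.unit_mul, zero_add, hy, A.pow_frame hf] at h2
      have h3 : A.tr (D n) = (n * (2 * A.tr (A.mul p (∑ j, lam j ^ n • f j)))) / s := by
        rw [eq_div_iff hs, ← h2]
        ring
      rw [h3, map_sum, map_sum, Finset.mul_sum, Finset.mul_sum, Finset.sum_div]
      refine Finset.sum_congr rfl fun j _ => ?_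
      rw [map_smul, map_smul, ha]
      rcases n with _ | n
      · simp
      · simp
        field_simp
        ring)
  obtain ⟨-, d, h1, h2⟩ := key
  have e1 : (fun t => A.jdet (γ t)) = fun u => MvPolynomial.eval (fun n => A.tr (A.pow (γ u) n)) P :=
    funext fun t => A.jdet_newton hP _
  have h2' : HasDerivAt (fun u => ∏ j, (lam j * (1 + a j * (u - s)))) d s := by
    convert h2 using 2 with u
    rw [hP]
  have h3 := HasDerivAt.fun_finsetProd (u := Finset.univ) fun j _ => hlin j
  have hd := h2'.unique h3
  rw [e1]
  convert h1 using 1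
  rw [hd, hy, A.jdet_frame f lam hf, ← hsum, Finset.sum_mul]
  refine Finset.sum_congr rfl fun j _ => ?_
  simp only [sub_self, mul_zero, add_zero, mul_one, smul_eq_mul]
  rw [← Finset.mul_prod_erase _ _ (Finset.mem_univ j)]
  ring

end EJA

theorem EJA.jdet_scale {J : Type} [NormedAddCommGroup J] [NormedSpace ℝ J]
    [FiniteDimensional ℝ J] (A : EJA J) {c y1 yh y0 : J} {m : ℕ} (_hc : A.mul c c = c)
    (hm : A.tr (A.e - c) = (m : ℝ)) (h1 : A.mul c y1 = y1) (hh : A.mul c yh = (1/2:ℝ) • yh)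
    (h0 : A.mul c y0 = 0) (s : ℝ) :
    A.jdet (y1 + s • yh + s ^ 2 • y0) = s ^ (2 * m) * A.jdet (y1 + yh + y0) := by
  obtain ⟨q, hq⟩ := EJA.PC.jdet A (γ := fun u : ℝ => y1 + u • yh + u ^ 2 • y0)
    (by simpa using EJA.PC.add (EJA.PC.add (EJA.PC.mono 0 y1) (EJA.PC.mono 1 yh))
          (EJA.PC.mono 2 y0))
  have hder : ∀ u : ℝ, u ≠ 0 → u * q.derivative.eval u = 2 * m * q.eval u := by
    intro u hu
    have hγ : HasDerivAt (fun u : ℝ => y1 + u • yh + u ^ 2 • y0) (yh + (2 * u) • y0) u := by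
      have a1 := ((hasDerivAt_id u).smul_const yh).const_add y1
      have a2 := (_root_.hasDerivAt_pow 2 u).smul_const y0
      simpa using a1.fun_add a2
    have h := A.jdet_deriv hu hγ (A.e - c) (by
      simp only [map_sub, LinearMap.sub_apply, A.unit_mul, map_add, map_smul, h1, hh, h0]
      module)
    have e : (fun t : ℝ => A.jdet (y1 + t • yh + t ^ 2 • y0)) = fun t => q.eval t := funext hq
    rw [e] at h
    have hu' := hq u
    rw [hu', hm] at h
    rw [(q.hasDerivAt u).unique h]
    field_simp
  have hpoly : Polynomial.X * q.derivative = Polynomial.C (2 * (m:ℝ)) * q := by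
    apply mul_left_cancel₀ (Polynomial.X_ne_zero (R := ℝ))
    apply Polynomial.funext
    intro u
    by_cases hu : u = 0
    · simp [hu]
    · simp only [Polynomial.eval_mul, Polynomial.eval_X, Polynomial.eval_C]
      rw [hder u hu]
  have hcoef : ∀ i, i ≠ 2 * m → q.coeff i = 0 := by
    intro i hi
    have h := congrArg (fun r => Polynomial.coeff r i) hpoly
    simp only [Polynomial.coeff_C_mul] at h
    have h' : (Polynomial.X * q.derivative).coeff i = i * q.coeff i := by
      rcases i with _ | i
      · simp
      · rw [Polynomial.coeff_X_mul, Polynomial.coeff_derivative]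
        push_cast
        ring
    rw [h'] at h
    have h2 : ((i:ℝ) - 2 * m) * q.coeff i = 0 := by linarith
    rcases mul_eq_zero.1 h2 with h3 | h3
    · exact absurd (by exact_mod_cast (sub_eq_zero.1 h3)) hi
    · exact h3
  have hq' : q = Polynomial.C (q.coeff (2 * m)) * Polynomial.X ^ (2 * m) := by
    ext i
    rw [Polynomial.coeff_C_mul, Polynomial.coeff_X_pow]
    by_cases hi : i = 2 * m
    · simp [hi]
    · simp [hi, hcoef i hi]
  have hs := hq s
  have h1' := hq 1
  rw [hq'] at hs h1'
  simp at hs h1'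
  rw [hs, h1']
  ring


/-- Let `x ∈ J` be of rank `k`, let `c` be the (unique) idempotent of
rank `k` with `c·x = x`, and let `ω ∈ Ω` have Peirce decomposition
`ω = ω₁ + ω_{1/2} + ω₀` relative to `c`.  Then, as `t → 0⁺`,
`det(x + tω) = t^{r−k} det_c(x) det_{e−c}(ω₀) + O(t^{r−k+1})`, where `det_c`, `det_{e−c}`
are the determinants of the subalgebras `J(c,1)` and `J(c,0)` (characterized by their
values on spectral decompositions relative to these subalgebras). -/
theorem EJA.jdet_expansion {J : Type} [NormedAddCommGroup J] [NormedSpace ℝ J]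
    [FiniteDimensional ℝ J] (A : EJA J) (x : J) (k : ℕ) (hxk : A.HasRank x k)
    (c : J) (hc : A.IsIdem c) (hck : A.HasRank c k) (hcx : A.mul c x = x)
    (detc det0 : J → ℝ)
    (hdetc : ∀ (m : ℕ) (d : Fin m → J) (lam : Fin m → ℝ),
      (∀ j, A.IsPrimitive (d j)) → (∀ i j, i ≠ j → A.mul (d i) (d j) = 0) →
      (∑ j, d j = c) → detc (∑ j, lam j • d j) = ∏ j, lam j)
    (hdet0 : ∀ (m : ℕ) (d : Fin m → J) (lam : Fin m → ℝ),
      (∀ j, A.IsPrimitive (d j)) → (∀ i j, i ≠ j → A.mul (d i) (d j) = 0) →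
      (∑ j, d j = A.e - c) → det0 (∑ j, lam j • d j) = ∏ j, lam j)
    (ω ω1 ωh ω0 : J) (hΩ : ω ∈ A.cone)
    (h1 : ω1 ∈ A.peirce c 1) (hh : ωh ∈ A.peirce c (1/2)) (h0 : ω0 ∈ A.peirce c 0)
    (hdec : ω = ω1 + ωh + ω0) :
    (fun t : ℝ => A.jdet (x + t • ω) - t ^ (A.rank - k) * (detc x * det0 ω0))
      =O[nhdsWithin 0 (Set.Ioi 0)] fun t : ℝ => t ^ (A.rank - k + 1) := by
  have hc' : A.mul c c = c := hc
  obtain ⟨htr, hkr⟩ := A.tr_of_rank hc hck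
  have hm : A.tr (A.e - c) = ((A.rank - k : ℕ) : ℝ) := by
    rw [map_sub, A.tr_e, htr, Nat.cast_sub hkr]
  generalize A.rank - k = m at hm ⊢
  rw [EJA.mem_peirce'] at h1 hh h0
  rw [one_smul] at h1
  rw [zero_smul] at h0
  rw [← A.jdet_prod hc hcx h0 detc det0 hdetc hdet0]
  obtain ⟨f, hf⟩ := EJA.PC.jdet A (γ := fun t : ℝ => x + t • ω)
    (by simpa using EJA.PC.add (EJA.PC.mono 0 x) (EJA.PC.mono 1 ω))
  obtain ⟨K, hK⟩ := EJA.PC.jdet A (γ := fun u : ℝ => (x + ω0) + u • ωh + u ^ 2 • ω1)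
    (by simpa using EJA.PC.add (EJA.PC.add (EJA.PC.mono 0 (x + ω0)) (EJA.PC.mono 1 ωh))
          (EJA.PC.mono 2 ω1))
  have hfK : ∀ u : ℝ, u ≠ 0 → f.eval (u ^ 2) = u ^ (2 * m) * K.eval u := by
    intro u hu
    have h := A.jdet_scale hc' hm (y1 := x + u ^ 2 • ω1) (yh := u ^ 2 • ωh) (y0 := u ^ 2 • ω0)
      (by simp [hcx, h1]) (by rw [map_smul, hh, smul_comm]) (by simp [h0]) u⁻¹
    have e1 : x + u ^ 2 • ω1 + u ^ 2 • ωh + u ^ 2 • ω0 = x + u ^ 2 • ω := by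
      rw [hdec]
      module
    have e2 : x + u ^ 2 • ω1 + u⁻¹ • u ^ 2 • ωh + u⁻¹ ^ 2 • u ^ 2 • ω0
        = (x + ω0) + u • ωh + u ^ 2 • ω1 := by
      rw [smul_smul, smul_smul, show u⁻¹ * u ^ 2 = u by field_simp,
        show u⁻¹ ^ 2 * u ^ 2 = 1 by field_simp]
      module
    rw [e1, e2] at h
    have hK' := hK u
    have hf' := hf (u ^ 2)
    rw [← hf', ← hK', h, inv_pow, mul_inv_cancel_left₀ (pow_ne_zero _ hu)]
  have hpoly : Polynomial.expand ℝ 2 f = Polynomial.X ^ (2 * m) * K := by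
    apply mul_left_cancel₀ (Polynomial.X_ne_zero (R := ℝ))
    apply Polynomial.funext
    intro u
    by_cases hu : u = 0
    · simp [hu]
    · simp [Polynomial.expand_eval, hfK u hu]
  have hcoef : ∀ i, f.coeff i = (Polynomial.X ^ (2 * m) * K).coeff (i * 2) := by
    intro i
    rw [← hpoly, Polynomial.coeff_expand_mul (by norm_num)]
  have hK0 : A.jdet (x + ω0) = K.coeff 0 := by
    have := hK 0
    rw [Polynomial.coeff_zero_eq_eval_zero, ← this]
    simp
  have hdvd : Polynomial.X ^ (m + 1) ∣ f - Polynomial.C (K.coeff 0) * Polynomial.X ^ m := by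
    rw [Polynomial.X_pow_dvd_iff]
    intro d hd
    rw [Polynomial.coeff_sub, hcoef, Polynomial.coeff_X_pow_mul', Polynomial.coeff_C_mul,
      Polynomial.coeff_X_pow]
    rcases Nat.lt_succ_iff_lt_or_eq.1 hd with h | h
    · rw [if_neg (by omega), if_neg (by omega)]
      simp
    · subst h
      rw [if_pos (by omega), if_pos rfl, show d * 2 - 2 * d = 0 by omega]
      simp
  obtain ⟨q, hq⟩ := hdvd
  have hfun : (fun t : ℝ => A.jdet (x + t • ω) - t ^ m * A.jdet (x + ω0))
      = fun t : ℝ => t ^ (m + 1) * q.eval t := by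
    funext t
    have h := congrArg (Polynomial.eval t) hq
    simp only [Polynomial.eval_sub, Polynomial.eval_mul, Polynomial.eval_C, Polynomial.eval_pow,
      Polynomial.eval_X] at h
    have hf' := hf t
    rw [hK0, hf', ← h]
    ring
  rw [hfun]
  have hqO : (fun t : ℝ => q.eval t) =O[nhdsWithin 0 (Set.Ioi 0)] fun _ : ℝ => (1:ℝ) :=
    (q.continuous.continuousWithinAt (s := Set.Ioi 0) (x := 0)).isBigO_one ℝ
  have := (isBigO_refl (fun t : ℝ => t ^ (m + 1)) (nhdsWithin 0 (Set.Ioi 0))).mul hqO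
  simpa using this
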